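/- Let L be a finite lattice and let d_max denote the maximum, over x ∈ L, of the number of elements covering x. Then for every completely monotone function f on L and every real α such that α is a positive integer or α ≥ d_max − 1, the pointwise power f^α is completely monotone. -/

import Mathlib

/-- A function `f` on a lattice `L` is completely monotone if it is nonnegative and all its
successive discrete derivatives `Δ_{x_k} … Δ_{x_1} f (x) =
Σ_{J ⊆ [k]} (−1)^{|J|} f(x ∨ ⋁_{i∈J} x_i)` are nonnegative. -/
def IsCM {L : Type*} [Lattice L] (f : L → ℝ) : Prop :=
  (∀ x, 0 ≤ f x) ∧
  ∀ (k : ℕ) (x : L) (y : Fin (k + 1) → L),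
    0 ≤ ∑ J : Finset (Fin (k + 1)),
      (-1 : ℝ) ^ J.card * f (J.fold (· ⊔ ·) x y)

def cmD {L : Type*} [Lattice L] : List L → (L → ℝ) → L → ℝ
  | [], f, x => f x
  | a :: l, f, x => cmD l f x - cmD l f (x ⊔ a)

section aux
variable {L : Type*} [Lattice L]

theorem cmD_add (l : List L) (f g : L → ℝ) (x : L) :
    cmD l (fun z => f z + g z) x = cmD l f x + cmD l g x := by
  induction l generalizing x with
  | nil => rfl
  | cons a l ih => simp only [cmD, ih]; ring

theorem cmD_sub (l : List L) (f g : L → ℝ) (x : L) :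
    cmD l (fun z => f z - g z) x = cmD l f x - cmD l g x := by
  induction l generalizing x with
  | nil => rfl
  | cons a l ih => simp only [cmD, ih]; ring

theorem cmD_smul (l : List L) (c : ℝ) (f : L → ℝ) (x : L) :
    cmD l (fun z => c * f z) x = c * cmD l f x := by
  induction l generalizing x with
  | nil => rfl
  | cons a l ih => simp only [cmD, ih]; ring

theorem cmD_shift (l : List L) (a : L) (f : L → ℝ) (x : L) :
    cmD l (fun z => f (z ⊔ a)) x = cmD l f (x ⊔ a) := by
  induction l generalizing x with
  | nil => rfl
  | cons b l ih => simp only [cmD, ih, sup_right_comm x b a]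

theorem cmD_cons (l : List L) (a : L) (f : L → ℝ) (x : L) :
    cmD (a :: l) f x = cmD l (fun z => f z - f (z ⊔ a)) x := by
  rw [cmD_sub, cmD_shift]; rfl

theorem cmD_perm {l l' : List L} (h : l.Perm l') (f : L → ℝ) (x : L) :
    cmD l f x = cmD l' f x := by
  induction h generalizing x with
  | nil => rfl
  | cons a _ ih => simp only [cmD, ih]
  | swap a b l => simp only [cmD, sup_right_comm x a b]; ring
  | trans _ _ ih1 ih2 => rw [ih1, ih2]

theorem cmD_zero {l : List L} {c : L} (hc : c ∈ l) (f : L → ℝ) (x : L) (hx : c ≤ x) :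
    cmD l f x = 0 := by
  induction l generalizing x with
  | nil => simp at hc
  | cons a l ih =>
    rcases List.mem_cons.1 hc with rfl | h
    · simp only [cmD, sup_eq_left.2 hx, sub_self]
    · simp only [cmD, ih h x hx, ih h (x ⊔ a) (hx.trans le_sup_left), sub_self]

def CMn (n : ℕ) (f : L → ℝ) : Prop := ∀ l : List L, l.length ≤ n → ∀ x, 0 ≤ cmD l f x

theorem CMn.mono {n m : ℕ} {f : L → ℝ} (h : CMn n f) (hm : m ≤ n) : CMn m f :=
  fun l hl x => h l (hl.trans hm) x

theorem CMn.shift {n : ℕ} {f : L → ℝ} (h : CMn n f) (a : L) : CMn n (fun z => f (z ⊔ a)) := by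
  intro l hl x
  rw [cmD_shift]; exact h l hl _

theorem CMn.diff {n : ℕ} {f : L → ℝ} (h : CMn (n + 1) f) (a : L) :
    CMn n (fun z => f z - f (z ⊔ a)) := by
  intro l hl x
  rw [← cmD_cons]; exact h (a :: l) (by simpa using hl) _

theorem CMn.add {n : ℕ} {f g : L → ℝ} (h : CMn n f) (h' : CMn n g) :
    CMn n (fun z => f z + g z) := by
  intro l hl x
  rw [cmD_add]; exact add_nonneg (h l hl x) (h' l hl x)

theorem CMn.smul {n : ℕ} {f : L → ℝ} (h : CMn n f) {c : ℝ} (hc : 0 ≤ c) :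
    CMn n (fun z => c * f z) := by
  intro l hl x
  rw [cmD_smul]; exact mul_nonneg hc (h l hl x)

theorem CMn.nonneg {n : ℕ} {f : L → ℝ} (h : CMn n f) (x : L) : 0 ≤ f x :=
  h [] (by simp) x

theorem CMn.mul {n : ℕ} {f g : L → ℝ} (h : CMn n f) (h' : CMn n g) :
    CMn n (fun z => f z * g z) := by
  induction n generalizing f g with
  | zero =>
    intro l hl x
    obtain rfl : l = [] := List.length_eq_zero_iff.1 (by omega)
    exact mul_nonneg (h.nonneg x) (h'.nonneg x)
  | succ n ih =>
    intro l hl x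
    cases l with
    | nil => exact mul_nonneg (h.nonneg x) (h'.nonneg x)
    | cons a l =>
      have e : (fun z => f z * g z - f (z ⊔ a) * g (z ⊔ a)) =
          fun z => (f z - f (z ⊔ a)) * g z + f (z ⊔ a) * (g z - g (z ⊔ a)) := by
        funext z; ring
      rw [cmD_cons, e]
      exact ((ih (h.diff a) (h'.mono n.le_succ)).add
        (ih ((h.mono n.le_succ).shift a) (h'.diff a))) l (by simpa using hl) x

theorem cmD_hasDerivAt (l : List L) (u : ℝ → L → ℝ) (u' : L → ℝ) (t : ℝ)
    (h : ∀ x, HasDerivAt (fun s => u s x) (u' x) t) (x : L) :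
    HasDerivAt (fun s => cmD l (u s) x) (cmD l u' x) t := by
  induction l generalizing x with
  | nil => exact h x
  | cons a l ih => exact (ih x).sub (ih (x ⊔ a))

theorem CMn.rpow {n : ℕ} {f : L → ℝ} (h : CMn n f) {α : ℝ} (hα : (n : ℝ) - 1 ≤ α) :
    CMn n (fun z => f z ^ α) := by
  induction n generalizing f α with
  | zero =>
    intro l hl x
    obtain rfl : l = [] := List.length_eq_zero_iff.1 (by omega)
    exact Real.rpow_nonneg (h.nonneg x) _
  | succ n ih =>
    intro l hl x
    cases l with
    | nil => exact Real.rpow_nonneg (h.nonneg x) _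
    | cons a l =>
      have hl' : l.length ≤ n := by simpa using hl
      push_cast at hα
      have hd := h.diff a
      rcases Nat.eq_zero_or_pos n with rfl | hn
      · obtain rfl : l = [] := List.length_eq_zero_iff.1 (by omega)
        have h1 := hd.nonneg x
        have h2 := h.nonneg (x ⊔ a)
        have := Real.rpow_le_rpow h2 (sub_nonneg.1 h1) (z := α) (by simpa using hα)
        simpa [cmD] using this
      · have hn1 : (1 : ℝ) ≤ n := by exact_mod_cast hn
        have hα1 : 1 ≤ α := by linarith
        let u : ℝ → L → ℝ := fun t z => f (z ⊔ a) + t * (f z - f (z ⊔ a))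
        have hder : ∀ t, HasDerivAt (fun s => cmD l (fun z => u s z ^ α) x)
            (cmD l (fun z => α * (u t z ^ (α - 1) * (f z - f (z ⊔ a)))) x) t := by
          intro t
          refine cmD_hasDerivAt l (fun s z => u s z ^ α) _ t (fun z => ?_) x
          have h1 : HasDerivAt (fun s => u s z) (f z - f (z ⊔ a)) t := by
            simpa [u] using
              ((hasDerivAt_id t).mul_const (f z - f (z ⊔ a))).const_add (f (z ⊔ a))
          have h2 := h1.rpow_const (p := α) (Or.inr hα1)
          convert h2 using 1
          ring
        have hmono : MonotoneOn (fun s => cmD l (fun z => u s z ^ α) x) (Set.Ici 0) := by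
          refine monotoneOn_of_deriv_nonneg (convex_Ici 0)
            (fun t _ => (hder t).continuousAt.continuousWithinAt)
            (fun t _ => (hder t).differentiableAt.differentiableWithinAt) (fun t ht => ?_)
          rw [(hder t).deriv]
          have ht0 : 0 ≤ t := interior_subset ht
          have hu : CMn n (u t) := ((h.mono n.le_succ).shift a).add (hd.smul ht0)
          exact (((ih hu (α := α - 1) (by linarith)).mul hd).smul (by linarith)) l hl' x
        have h01 := hmono (Set.mem_Ici.2 le_rfl) (Set.mem_Ici.2 zero_le_one) zero_le_one
        have e0 : u 0 = fun z => f (z ⊔ a) := by funext z; simp [u]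
        have e1 : u 1 = f := by funext z; simp [u]
        simp only [e0, e1] at h01
        rw [cmD_cons, cmD_sub]
        linarith

theorem cm_fold_sup {ι : Type*} [DecidableEq ι] (J : Finset ι) (x a : L) (y : ι → L) :
    J.fold ((· ⊔ ·) : L → L → L) (x ⊔ a) y = a ⊔ J.fold ((· ⊔ ·) : L → L → L) x y := by
  induction J using Finset.induction_on with
  | empty => simp [sup_comm]
  | insert i s hi ih => rw [Finset.fold_insert hi, Finset.fold_insert hi, ih, sup_left_comm]

theorem cm_sum_eq {ι : Type*} [DecidableEq ι] (l : List ι) (hl : l.Nodup) (f : L → ℝ)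
    (y : ι → L) (x : L) :
    ∑ J ∈ l.toFinset.powerset, (-1 : ℝ) ^ J.card * f (J.fold (· ⊔ ·) x y)
      = cmD (l.map y) f x := by
  induction l generalizing x with
  | nil => simp [cmD]
  | cons i l ih =>
    have hi : i ∉ l.toFinset := by simpa using (List.nodup_cons.1 hl).1
    have ih' := ih (List.nodup_cons.1 hl).2
    rw [List.toFinset_cons, Finset.sum_powerset_insert hi, List.map_cons, cmD, ih', ← ih',
      ← ih', sub_eq_add_neg, ← Finset.sum_neg_distrib]
    congr 1
    refine Finset.sum_congr rfl fun J hJ => ?_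
    have hiJ : i ∉ J := fun h => hi (Finset.mem_powerset.1 hJ h)
    rw [Finset.card_insert_of_notMem hiJ, Finset.fold_insert hiJ, cm_fold_sup, pow_succ]
    ring

theorem isCM_iff (f : L → ℝ) : IsCM f ↔ ∀ n, CMn n f := by
  have key : ∀ (k : ℕ) (x : L) (y : Fin (k + 1) → L),
      ∑ J : Finset (Fin (k + 1)), (-1 : ℝ) ^ J.card * f (J.fold (· ⊔ ·) x y)
        = cmD ((List.finRange (k + 1)).map y) f x := by
    intro k x y
    rw [← cm_sum_eq (List.finRange (k + 1)) (List.nodup_finRange _)]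
    simp
  constructor
  · rintro ⟨h0, h⟩ n l - x
    cases l with
    | nil => exact h0 x
    | cons a l =>
      have := h l.length x (a :: l).get
      rw [key] at this
      have e : (List.finRange (l.length + 1)).map (a :: l).get = a :: l :=
        List.map_get_finRange (a :: l)
      rwa [e] at this
  · intro h
    refine ⟨(h 0).nonneg, fun k x y => ?_⟩
    rw [key]
    exact h _ _ le_rfl x

theorem cm_of_covers [Finite L] (h : L → ℝ) (cov : L → List L)
    (hc1 : ∀ x, ∀ c ∈ cov x, x < c) (hc2 : ∀ x z, x < z → ∃ c ∈ cov x, c ≤ z)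
    (hc : ∀ x, 0 ≤ cmD (cov x) h x) (x : L) : ∀ l : List L, 0 ≤ cmD l h x := by
  induction x using WellFoundedGT.induction with
  | ind x IH =>
    intro l
    by_cases hl : ∃ a ∈ l, a ≤ x
    · obtain ⟨a, ha, hax⟩ := hl
      rw [cmD_zero ha h x hax]
    push Not at hl
    have s1 : ∀ m : List L, (∀ c ∈ m, x < c) → cmD (m ++ l) h x ≤ cmD l h x := by
      intro m hm
      induction m with
      | nil => exact le_rfl
      | cons c m ihm =>
        have hxc : x < c := hm c (by simp)
        have h1 := ihm fun c hc => hm c (by simp [hc])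
        have h2 := IH (x ⊔ c) (lt_of_lt_of_le hxc le_sup_right) (m ++ l)
        rw [List.cons_append, cmD]
        linarith
    have s2 : cmD (l ++ cov x) h x = cmD (cov x) h x := by
      clear s1
      induction l with
      | nil => rfl
      | cons a l ihl =>
        have hxa : x < x ⊔ a := by
          refine lt_of_le_of_ne le_sup_left fun e => hl a (by simp) ?_
          rw [e]; exact le_sup_right
        obtain ⟨c, hcm, hca⟩ := hc2 x _ hxa
        rw [List.cons_append, cmD, ihl fun b hb => hl b (by simp [hb]),
          cmD_zero (List.mem_append_right l hcm) h _ hca, sub_zero]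
    have := s1 (cov x) (hc1 x)
    rw [cmD_perm List.perm_append_comm, s2] at this
    exact (hc x).trans this

end aux

theorem stmt2 {L : Type*} [Lattice L] [Fintype L] (f : L → ℝ) (hf : IsCM f)
    (α : ℝ)
    (hα : (∃ j : ℕ, 0 < j ∧ α = j) ∨
      ((Finset.univ.sup (fun x : L => Nat.card {y : L // x ⋖ y}) : ℕ) : ℝ) - 1 ≤ α) :
    IsCM (fun x => f x ^ α) := by
  classical
  rw [isCM_iff] at hf ⊢
  rcases hα with ⟨j, hj, rfl⟩ | hα
  · intro n
    simp only [Real.rpow_natCast]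
    obtain ⟨m, rfl⟩ : ∃ m, j = m + 1 := ⟨j - 1, by omega⟩
    clear hj
    induction m with
    | zero => simpa using hf n
    | succ m ih =>
      simp only [pow_succ _ (m + 1)]
      exact ih.mul (hf n)
  · intro n l _ x
    refine cm_of_covers _ (fun x => (Finset.univ.filter (fun y => x ⋖ y)).toList) ?_ ?_ ?_ x l
    · intro x c hc
      simp at hc
      exact hc.lt
    · intro x z hxz
      obtain ⟨c, hc, hcz⟩ := exists_covBy_le_of_lt hxz
      exact ⟨c, by simpa using hc, hcz⟩
    · intro x
      refine (hf _).rpow ?_ _ le_rfl x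
      refine le_trans ?_ hα
      have h1 : Nat.card {y : L // x ⋖ y} ≤
          Finset.univ.sup (fun x : L => Nat.card {y : L // x ⋖ y}) :=
        Finset.le_sup (f := fun x : L => Nat.card {y : L // x ⋖ y}) (Finset.mem_univ x)
      have h2 : (Finset.univ.filter (fun y => x ⋖ y)).toList.length
          = Nat.card {y : L // x ⋖ y} := by
        rw [Finset.length_toList, Nat.card_eq_fintype_card, Fintype.card_subtype]
      rw [h2]
      have h3 : ((Nat.card {y : L // x ⋖ y} : ℕ) : ℝ) ≤ _ := Nat.cast_le.2 h1
      linarith
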